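/- Let a, b, c, μ ∈ ℂ with Re(a-c+1) > Re μ > 0 and Re(b-c+1) > Re μ > 0, and assume that neither 2-c nor 2-c-μ is a nonpositive integer. Then for every real x ∈ (-∞,0) ∪ (0,1), ∫_{-∞}^{x} |y|^{c-1} w₂(y;a,b,c) · (x-y)^{μ-1}/Γ(μ) dy = (Γ(a-c-μ+1)/Γ(a-c+1)) · (Γ(b-c-μ+1)/Γ(b-c+1)) · (Γ(2-c)/Γ(2-c-μ)) · |x|^{c+μ-1} · w₂(x;a,b,c+μ), where w₂(x;a,b,c) := |x|^{1-c} F(a-c+1, b-c+1; 2-c; x) (a fractional integral transformation of type c+ for the solution w₂ of the hypergeometric differential equation). -/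

import Mathlib

open MeasureTheory Set Complex Filter

/-- Pochhammer symbol `(a)_k = a (a+1) ⋯ (a+k-1)`. -/
noncomputable def poch (a : ℂ) (k : ℕ) : ℂ := ∏ i ∈ Finset.range k, (a + i)

/-- The Gauss hypergeometric function `F(a,b;c;x)` for real `x < 1`, defined by the
power series on `[0,1)` and by the (agreeing) Pfaff series for `x < 0`. -/
noncomputable def hypF (a b c : ℂ) (x : ℝ) : ℂ :=
  if 0 ≤ x then
    ∑' k : ℕ, poch a k * poch b k / (poch c k * (Nat.factorial k : ℂ)) * (x : ℂ) ^ k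
  else
    ((1 - x : ℝ) : ℂ) ^ (-a) *
      ∑' k : ℕ, poch a k * poch (c - b) k / (poch c k * (Nat.factorial k : ℂ)) *
        (((x / (x - 1) : ℝ)) : ℂ) ^ k

/-- Kummer's solution `w₂(x;a,b,c) = |x|^{1-c} F(a-c+1,b-c+1;2-c;x)`. -/
noncomputable def w2 (a b c : ℂ) (x : ℝ) : ℂ :=
  ((|x| : ℝ) : ℂ) ^ (1 - c) * hypF (a - c + 1) (b - c + 1) (2 - c) x

open scoped Topology

lemma poch_zero' (a : ℂ) : poch a 0 = 1 := by simp [poch]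

lemma poch_succ' (a : ℂ) (k : ℕ) : poch a (k + 1) = poch a k * (a + k) := by
  simp [poch, Finset.prod_range_succ]

lemma poch_add' (a : ℂ) (n k : ℕ) : poch a (n + k) = poch a n * poch (a + n) k := by
  simp only [poch, Finset.prod_range_add]
  congr 1
  refine Finset.prod_congr rfl fun i _ => ?_
  push_cast; ring

lemma poch_ne (a : ℂ) (h : ∀ n : ℕ, a ≠ -(n : ℂ)) (k : ℕ) : poch a k ≠ 0 := by
  refine Finset.prod_ne_zero_iff.2 fun i _ hi => h i ?_
  linear_combination hi

lemma shift_nonpole {a : ℂ} (h : ∀ n : ℕ, a ≠ -(n : ℂ)) (m : ℕ) :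
    ∀ n : ℕ, a + m ≠ -(n : ℂ) := by
  intro n hn
  apply h (n + m)
  push_cast
  linear_combination hn

lemma nonpole_of_re {a : ℂ} (h : 0 < a.re) : ∀ n : ℕ, a ≠ -(n : ℂ) := by
  intro n hn
  rw [hn] at h
  simp at h
  have : (0:ℝ) ≤ n := n.cast_nonneg
  linarith

lemma Gamma_add_nat' (a : ℂ) (h : ∀ n : ℕ, a ≠ -(n : ℂ)) (n : ℕ) :
    Complex.Gamma (a + n) = poch a n * Complex.Gamma a := by
  induction n with
  | zero => simp [poch_zero']
  | succ n ih =>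
    have : a + (n : ℂ) ≠ 0 := fun h0 => h n (by linear_combination h0)
    rw [poch_succ', Nat.cast_succ, ← add_assoc, Complex.Gamma_add_one _ this, ih]; ring

lemma GammaSeq_poch (s : ℂ) (n : ℕ) :
    Complex.GammaSeq s n = (n : ℂ) ^ s * n.factorial / poch s (n + 1) := rfl

lemma rpow_comp {x y K : ℝ} (hx : 0 < x) (hy : 0 < y) (hK : 1 ≤ K) (h1 : x ≤ K * y)
    (h2 : y ≤ K * x) (α : ℝ) : x ^ α ≤ K ^ |α| * y ^ α := by
  have hK0 : 0 < K := by linarith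
  rcases le_total 0 α with h | h
  · rw [abs_of_nonneg h, ← Real.mul_rpow hK0.le hy.le]
    exact Real.rpow_le_rpow hx.le h1 h
  · rw [abs_of_nonpos h, Real.rpow_neg hK0.le, ← Real.inv_rpow hK0.le, ← Real.mul_rpow (by positivity) hy.le]
    apply Real.rpow_le_rpow_of_nonpos (by positivity) _ h
    rw [inv_mul_le_iff₀ hK0]; exact h2

lemma peetre (n k : ℕ) (α : ℝ) :
    ((n + k : ℕ) + 1 : ℝ) ^ α ≤ ((n : ℝ) + 1) ^ |α| * ((k : ℝ) + 1) ^ α := by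
  have hn : (0:ℝ) ≤ n := n.cast_nonneg
  have hk : (0:ℝ) ≤ k := k.cast_nonneg
  apply rpow_comp <;> push_cast <;> nlinarith [mul_nonneg hn hk, mul_nonneg hn hn]

lemma norm_nat_cpow {n : ℕ} (hn : n ≠ 0) (s : ℂ) : ‖(n : ℂ) ^ s‖ = (n : ℝ) ^ s.re := by
  have : 0 < (n:ℝ) := by positivity
  rw [← Complex.norm_cpow_eq_rpow_re_of_pos this]; simp

lemma all_of_eventually {u v : ℕ → ℝ} (hv : ∀ n, 0 < v n) {M : ℝ}
    (h : ∀ᶠ n in atTop, |u n| ≤ M * v n) : ∃ M, 0 < M ∧ ∀ n, u n ≤ M * v n := by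
  have : u =O[atTop] v := by
    refine Asymptotics.IsBigO.of_bound M ?_
    filter_upwards [h] with n hn
    rwa [Real.norm_eq_abs, Real.norm_eq_abs, abs_of_pos (hv n)]
  obtain ⟨C, hC, h⟩ := Asymptotics.bound_of_isBigO_nat_atTop this
  refine ⟨C, hC, fun n => ?_⟩
  have := h (hv n).ne'
  rw [Real.norm_eq_abs, Real.norm_eq_abs, abs_of_pos (hv n)] at this
  exact (le_abs_self _).trans this

lemma poch_UB (a : ℂ) : ∃ M : ℝ, 0 < M ∧ ∀ k : ℕ,
    ‖poch a k‖ ≤ M * (k.factorial * ((k : ℝ) + 1) ^ (a.re - 1)) := by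
  by_cases h : ∀ n : ℕ, a ≠ -(n : ℂ)
  · have ht : Tendsto (fun n => ‖(Complex.GammaSeq a n)⁻¹‖) atTop (𝓝 ‖(Complex.Gamma a)⁻¹‖) :=
      ((Complex.GammaSeq_tendsto_Gamma a).inv₀ (Complex.Gamma_ne_zero h)).norm
    have hb : ∀ᶠ n in atTop, ‖(Complex.GammaSeq a n)⁻¹‖ ≤ ‖(Complex.Gamma a)⁻¹‖ + 1 :=
      ht.eventually_le_const (by linarith)
    set M0 := ‖(Complex.Gamma a)⁻¹‖ + 1
    have hM0 : 0 ≤ M0 := by positivity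
    apply all_of_eventually (fun n => by positivity) (M := M0 * 3 ^ |a.re| * 2)
    rw [← map_add_atTop_eq_nat 1, eventually_map]
    filter_upwards [hb, eventually_ge_atTop 1] with n hn hn1
    have hn0 : n ≠ 0 := by omega
    have hnp : (1:ℝ) ≤ n := by exact_mod_cast hn1
    rw [abs_of_nonneg (norm_nonneg _)]
    rw [GammaSeq_poch, inv_div, norm_div, norm_mul, norm_nat_cpow hn0, div_le_iff₀ (by
      have := n.factorial_pos
      simp only [Complex.norm_natCast]; positivity), Complex.norm_natCast] at hn
    refine hn.trans ?_
    have h1 : (n:ℝ) ^ a.re ≤ 3 ^ |a.re| * ((n:ℝ) + 1 + 1) ^ a.re :=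
      rpow_comp (by linarith) (by linarith) (by norm_num) (by linarith) (by linarith) _
    have h2 : ((n:ℝ) + 1 + 1) ^ a.re = ((n:ℝ) + 1 + 1) * ((n:ℝ) + 1 + 1) ^ (a.re - 1) := by
      rw [Real.rpow_sub_one (by linarith)]; field_simp
    have h3 : (0:ℝ) < ((n:ℝ) + 1 + 1) ^ (a.re - 1) := by positivity
    have h4 : (0:ℝ) < n.factorial := by exact_mod_cast n.factorial_pos
    rw [h2] at h1
    rw [Nat.factorial_succ]; push_cast
    have h5 : (0:ℝ) < 3 ^ |a.re| := by positivity
    calc M0 * ((n:ℝ) ^ a.re * n.factorial)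
        ≤ M0 * (3 ^ |a.re| * (((n:ℝ) + 1 + 1) * ((n:ℝ) + 1 + 1) ^ (a.re - 1)) * n.factorial) := by gcongr
      _ ≤ M0 * (3 ^ |a.re| * ((2 * ((n:ℝ) + 1)) * ((n:ℝ) + 1 + 1) ^ (a.re - 1)) * n.factorial) := by
          gcongr; linarith
      _ = _ := by ring
  · push Not at h
    obtain ⟨m, hm⟩ := h
    apply all_of_eventually (fun n => by positivity) (M := 1)
    filter_upwards [eventually_gt_atTop m] with n hn
    have : poch a n = 0 := Finset.prod_eq_zero (Finset.mem_range.2 hn) (by rw [hm]; ring)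
    rw [this]; simp; positivity

lemma poch_LB (c : ℂ) (_h : ∀ n : ℕ, c ≠ -(n : ℂ)) : ∃ M : ℝ, 0 < M ∧ ∀ k : ℕ,
    ‖poch c k‖⁻¹ ≤ M * ((k.factorial : ℝ)⁻¹ * ((k : ℝ) + 1) ^ (1 - c.re)) := by
  have ht : Tendsto (fun n => ‖Complex.GammaSeq c n‖) atTop (𝓝 ‖Complex.Gamma c‖) :=
      (Complex.GammaSeq_tendsto_Gamma c).norm
  have hb : ∀ᶠ n in atTop, ‖Complex.GammaSeq c n‖ ≤ ‖Complex.Gamma c‖ + 1 :=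
      ht.eventually_le_const (by linarith)
  set M0 := ‖Complex.Gamma c‖ + 1
  have hM0 : 0 ≤ M0 := by positivity
  apply all_of_eventually (fun n => by positivity) (M := M0 * 3 ^ |-c.re|)
  rw [← map_add_atTop_eq_nat 1, eventually_map]
  filter_upwards [hb, eventually_ge_atTop 1] with n hn hn1
  have hn0 : n ≠ 0 := by omega
  have hnp : (1:ℝ) ≤ n := by exact_mod_cast hn1
  rw [abs_of_nonneg (by positivity)]
  have h4 : (0:ℝ) < n.factorial := by exact_mod_cast n.factorial_pos
  have h6 : (0:ℝ) < (n:ℝ) ^ c.re := by positivity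
  rw [GammaSeq_poch, norm_div, norm_mul, norm_nat_cpow hn0, Complex.norm_natCast,
    div_eq_mul_inv, mul_comm, ← le_div_iff₀ (by positivity)] at hn
  refine hn.trans ?_
  have h1 : (n:ℝ) ^ (-c.re) ≤ 3 ^ |-c.re| * ((n:ℝ) + 1 + 1) ^ (-c.re) :=
      rpow_comp (by linarith) (by linarith) (by norm_num) (by linarith) (by linarith) _
  have h2 : ((n:ℝ) + 1 + 1) ^ (1 - c.re) = ((n:ℝ) + 1 + 1) * ((n:ℝ) + 1 + 1) ^ (-c.re) := by
      rw [sub_eq_add_neg, Real.rpow_add (by linarith), Real.rpow_one]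
  have h3 : (0:ℝ) < ((n:ℝ) + 1 + 1) ^ (-c.re) := by positivity
  have h5 : (0:ℝ) < 3 ^ |-c.re| := by positivity
  rw [Nat.factorial_succ]; push_cast
  rw [h2]
  calc M0 / ((n:ℝ) ^ c.re * n.factorial) = M0 * (n:ℝ) ^ (-c.re) * (n.factorial : ℝ)⁻¹ := by
        rw [Real.rpow_neg (by linarith)]; field_simp
    _ ≤ M0 * (3 ^ |-c.re| * ((n:ℝ) + 1 + 1) ^ (-c.re)) * (n.factorial : ℝ)⁻¹ := by gcongr
    _ ≤ M0 * (3 ^ |-c.re| * ((n:ℝ) + 1 + 1) ^ (-c.re)) * (n.factorial : ℝ)⁻¹ * (((n:ℝ)+1+1)/((n:ℝ)+1)) := by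
        apply le_mul_of_one_le_right (by positivity)
        rw [one_le_div (by linarith)]; linarith
    _ = _ := by field_simp

lemma summable_rpow_succ {s : ℝ} (hs : s < -1) : Summable (fun k : ℕ => ((k:ℝ) + 1) ^ s) := by
  have := (Real.summable_one_div_nat_add_rpow 1 (-s)).2 (by linarith)
  refine this.congr fun k => ?_
  have hk : (0:ℝ) ≤ k := k.cast_nonneg
  rw [abs_of_pos (by linarith), Real.rpow_neg (by linarith), one_div, inv_inv]

lemma summable_rpow_geom (L : ℝ) {r : ℝ} (h0 : 0 ≤ r) (h1 : r < 1) :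
    Summable (fun n : ℕ => ((n:ℝ) + 1) ^ L * r ^ n) := by
  obtain ⟨m, hm⟩ := exists_nat_ge L
  have hr' : 0 < (1 + r) / 2 := by linarith
  have hs := summable_pow_mul_geometric_of_norm_lt_one m (r := (1 + r) / 2)
    (by rw [Real.norm_of_nonneg hr'.le]; linarith)
  have hs2 := ((summable_nat_add_iff 1).2 hs).mul_left ((1 + r) / 2)⁻¹
  refine Summable.of_nonneg_of_le (fun n => by positivity) (fun n => ?_) hs2
  have hn : (0:ℝ) ≤ n := n.cast_nonneg
  have e1 : ((n:ℝ) + 1) ^ L ≤ ((n:ℝ) + 1) ^ m := by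
    rw [← Real.rpow_natCast]
    exact Real.rpow_le_rpow_of_exponent_le (by linarith) hm
  have e2 : r ^ n ≤ ((1 + r) / 2) ^ n := pow_le_pow_left₀ h0 (by linarith) n
  calc ((n:ℝ) + 1) ^ L * r ^ n ≤ ((n:ℝ) + 1) ^ m * ((1 + r) / 2) ^ n := by gcongr
    _ = _ := by push_cast; rw [pow_succ]; field_simp

/-- bound on hypergeometric coefficients -/
lemma coef_bound (a b c : ℂ) (h : ∀ n : ℕ, c ≠ -(n : ℂ)) : ∃ M : ℝ, 0 < M ∧ ∀ k : ℕ,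
    ‖poch a k * poch b k / (poch c k * (Nat.factorial k : ℂ))‖
      ≤ M * ((k : ℝ) + 1) ^ ((a + b - c).re - 1) := by
  obtain ⟨M1, hM1, h1⟩ := poch_UB a
  obtain ⟨M2, hM2, h2⟩ := poch_UB b
  obtain ⟨M3, hM3, h3⟩ := poch_LB c h
  refine ⟨M1 * M2 * M3, by positivity, fun k => ?_⟩
  have h4 : (0:ℝ) < k.factorial := by exact_mod_cast k.factorial_pos
  have hk : (0:ℝ) < (k:ℝ) + 1 := by positivity
  have e : ((k : ℝ) + 1) ^ ((a + b - c).re - 1) =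
    ((k : ℝ) + 1) ^ (a.re - 1) * ((k : ℝ) + 1) ^ (b.re - 1) * ((k : ℝ) + 1) ^ (1 - c.re) := by
    rw [← Real.rpow_add hk, ← Real.rpow_add hk]; congr 1; simp; ring
  rw [norm_div, norm_mul, norm_mul, Complex.norm_natCast, e]
  calc ‖poch a k‖ * ‖poch b k‖ / (‖poch c k‖ * k.factorial)
      = ‖poch a k‖ * ‖poch b k‖ * ‖poch c k‖⁻¹ * (k.factorial : ℝ)⁻¹ := by
        rw [div_eq_mul_inv, mul_inv]; ring
    _ ≤ (M1 * (k.factorial * ((k : ℝ) + 1) ^ (a.re - 1))) * (M2 * (k.factorial * ((k : ℝ) + 1) ^ (b.re - 1)))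
        * (M3 * ((k.factorial : ℝ)⁻¹ * ((k : ℝ) + 1) ^ (1 - c.re))) * (k.factorial : ℝ)⁻¹ := by
        gcongr
        · exact h1 k
        · exact h2 k
        · exact h3 k
    _ = _ := by field_simp

/-! ### Gauss summation -/

lemma gauss_summable (a b c : ℂ) (h : ∀ n : ℕ, c ≠ -(n : ℂ)) (hre : 0 < (c - a - b).re) :
    Summable (fun k : ℕ => poch a k * poch b k / (poch c k * (Nat.factorial k : ℂ))) := by
  obtain ⟨M, hM, hb⟩ := coef_bound a b c h
  refine Summable.of_norm_bounded ((summable_rpow_succ (s := (a + b - c).re - 1) ?_).mul_left M) hb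
  simp at hre ⊢; linarith

lemma poch_shift (c : ℂ) (k : ℕ) : c * poch (c + 1) k = poch c k * (c + k) := by
  rw [← poch_succ', add_comm k 1, poch_add']
  simp [poch]

lemma gauss_rec (a b c : ℂ) (h : ∀ n : ℕ, c ≠ -(n : ℂ)) (hre : 0 < (c - a - b).re) :
    c * (c - a - b) * ∑' k : ℕ, poch a k * poch b k / (poch c k * (Nat.factorial k : ℂ)) =
    (c - a) * (c - b) * ∑' k : ℕ, poch a k * poch b k / (poch (c + 1) k * (Nat.factorial k : ℂ)) := by
  have hs := gauss_summable a b c h hre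
  have h' : ∀ n : ℕ, c + 1 ≠ -(n : ℂ) := by simpa using shift_nonpole h 1
  have hs' := gauss_summable a b (c + 1) h' (by simp at hre ⊢; linarith)
  set u : ℕ → ℂ := fun k => poch a k * poch b k / (poch c k * (Nat.factorial k : ℂ)) with hu
  have hd : HasSum (fun k : ℕ => c * (c - a - b) * u k -
      (c - a) * (c - b) * (poch a k * poch b k / (poch (c + 1) k * (Nat.factorial k : ℂ)))) 0 := by
    have key : ∀ k : ℕ, c * (c - a - b) * u k -
      (c - a) * (c - b) * (poch a k * poch b k / (poch (c + 1) k * (Nat.factorial k : ℂ)))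
        = c * (k * u k) - c * ((k + 1 : ℕ) * u (k + 1)) := by
      intro k
      have e1 := poch_ne c h k
      have e2 := poch_ne (c + 1) h' k
      have e3 : c + k ≠ 0 := fun h0 => h k (by linear_combination h0)
      have e4 : c ≠ 0 := by simpa using h 0
      have e5 : (k.factorial : ℂ) ≠ 0 := by exact_mod_cast k.factorial_ne_zero
      have e6 : (k : ℂ) + 1 ≠ 0 := by exact_mod_cast k.succ_ne_zero
      have e7 : poch (c + 1) k = poch c k * (c + k) / c := by
        rw [eq_div_iff e4, ← poch_shift]; ring
      simp only [hu]
      rw [e7, poch_succ', poch_succ', poch_succ', Nat.factorial_succ]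
      push_cast
      field_simp
      ring
    have ht : Tendsto (fun k : ℕ => c * (k * u k)) atTop (𝓝 0) := by
      rw [show (0:ℂ) = c * 0 by simp]
      refine Tendsto.const_mul c ?_
      obtain ⟨M, hM, hb⟩ := coef_bound a b c h
      have ht0 : Tendsto (fun k : ℕ => M * ((k : ℝ) + 1) ^ ((a + b - c).re)) atTop (𝓝 (M * 0)) := by
        refine Tendsto.const_mul M ?_
        have := (tendsto_rpow_neg_atTop (y := -(a + b - c).re) (by simp at hre ⊢; linarith))
        simp only [neg_neg] at this
        exact this.comp (tendsto_atTop_add_const_right _ _ tendsto_natCast_atTop_atTop)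
      rw [mul_zero] at ht0
      refine squeeze_zero_norm (fun k => ?_) ht0
      have hk : (0:ℝ) < (k:ℝ) + 1 := by positivity
      rw [norm_mul, Complex.norm_natCast]
      calc (k:ℝ) * ‖u k‖ ≤ ((k:ℝ) + 1) * (M * ((k : ℝ) + 1) ^ ((a + b - c).re - 1)) := by
            gcongr
            · linarith
            · exact hb k
        _ = _ := by rw [Real.rpow_sub_one hk.ne']; field_simp
    have hsum := (hs.mul_left (c * (c - a - b))).sub (hs'.mul_left ((c - a) * (c - b)))
    rw [hsum.hasSum_iff_tendsto_nat]
    have : ∀ n, ∑ k ∈ Finset.range n, (c * (c - a - b) * u k -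
      (c - a) * (c - b) * (poch a k * poch b k / (poch (c + 1) k * (Nat.factorial k : ℂ)))) =
      -(c * (n * u n)) := by
      intro n
      rw [Finset.sum_congr rfl fun k _ => key k, Finset.sum_range_sub' (fun k : ℕ => c * (k * u k))]
      simp
    simp_rw [this]
    simpa using ht.neg
  have h2 := ((hs.hasSum.mul_left (c * (c - a - b))).sub (hs'.hasSum.mul_left ((c - a) * (c - b)))).unique hd
  linear_combination h2

lemma gauss_iter (a b c : ℂ) (h : ∀ n : ℕ, c ≠ -(n : ℂ)) (hre : 0 < (c - a - b).re) (N : ℕ) :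
    poch c N * poch (c - a - b) N * ∑' k : ℕ, poch a k * poch b k / (poch c k * (Nat.factorial k : ℂ)) =
    poch (c - a) N * poch (c - b) N *
      ∑' k : ℕ, poch a k * poch b k / (poch (c + N) k * (Nat.factorial k : ℂ)) := by
  induction N with
  | zero => simp [poch_zero']
  | succ N ih =>
    have := gauss_rec a b (c + N) (shift_nonpole h N) (by
      have : (0:ℝ) ≤ N := N.cast_nonneg
      simp at hre ⊢; linarith)
    simp only [poch_succ']
    rw [show c + ((N + 1 : ℕ) : ℂ) = c + N + 1 by push_cast; ring]
    linear_combination ((c + N) * (c - a - b + N)) * ih + poch (c - a) N * poch (c - b) N * this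

lemma gauss_lim (a b c : ℂ) :
    Tendsto (fun N : ℕ => ∑' k : ℕ, poch a k * poch b k / (poch (c + N) k * (Nat.factorial k : ℂ)))
      atTop (𝓝 1) := by
  have h1 : (1:ℂ) = ∑' k : ℕ, (if k = 0 then 1 else 0) := by simp
  rw [h1]
  set σ : ℝ := ‖a‖ + ‖b‖ + 1
  have hσ : 0 < σ := by positivity
  obtain ⟨M, hM, hb⟩ := coef_bound a b σ (nonpole_of_re (by simpa using hσ))
  have hsum : Summable (fun k : ℕ => M * ((k : ℝ) + 1) ^ ((a + b - σ).re - 1)) := by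
    refine (summable_rpow_succ ?_).mul_left M
    have := Complex.re_le_norm a
    have := Complex.re_le_norm b
    simp [σ]; linarith
  have hev : ∀ᶠ N : ℕ in atTop, σ ≤ (c + N).re := by
    have : Tendsto (fun N : ℕ => c.re + (N:ℝ)) atTop atTop :=
      tendsto_atTop_add_const_left _ _ tendsto_natCast_atTop_atTop
    filter_upwards [this.eventually_ge_atTop σ] with N hN
    simpa using hN
  refine tendsto_tsum_of_dominated_convergence hsum (fun k => ?_) ?_
  · rcases Nat.eq_zero_or_pos k with rfl | hk
    · simp [poch_zero']
    · rw [if_neg hk.ne']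
      have : Tendsto (fun N : ℕ => ‖poch (c + N) k * (Nat.factorial k : ℂ)‖) atTop atTop := by
        have t1 : Tendsto (fun N : ℕ => c.re + (N:ℝ)) atTop atTop :=
          tendsto_atTop_add_const_left _ _ tendsto_natCast_atTop_atTop
        refine tendsto_atTop_mono' _ ?_ t1
        filter_upwards [t1.eventually_ge_atTop 1] with N hN
        have hf : (1:ℝ) ≤ k.factorial := by exact_mod_cast k.factorial_pos
        rw [norm_mul, Complex.norm_natCast, poch, norm_prod]
        have hi : ∀ i ∈ Finset.range k, (1:ℝ) ≤ ‖c + N + i‖ := by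
          intro i _
          refine le_trans ?_ (Complex.re_le_norm _)
          have : (0:ℝ) ≤ i := i.cast_nonneg
          simp; linarith
        have hp : c.re + N ≤ ∏ i ∈ Finset.range k, ‖c + N + i‖ := by
          obtain ⟨j, rfl⟩ : ∃ j, k = j + 1 := ⟨k - 1, by omega⟩
          rw [Finset.prod_range_succ']
          have e1 : (1:ℝ) ≤ ∏ i ∈ Finset.range j, ‖c + N + ((i + 1 : ℕ) : ℂ)‖ := by
            have := Finset.prod_le_prod (s := Finset.range j) (f := fun _ => (1:ℝ))
              (g := fun i => ‖c + N + ((i + 1 : ℕ) : ℂ)‖) (fun _ _ => zero_le_one)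
              (fun i hi' => hi (i + 1) (by simpa using hi'))
            simpa using this
          have e2 : c.re + N ≤ ‖c + N + ((0 : ℕ) : ℂ)‖ := by
            refine le_trans ?_ (Complex.re_le_norm _); simp
          nlinarith [norm_nonneg (c + N + ((0 : ℕ) : ℂ))]
        nlinarith
      rw [tendsto_zero_iff_norm_tendsto_zero]
      simp_rw [norm_div]
      exact Tendsto.const_div_atTop this _
  · filter_upwards [hev] with N hN k
    refine le_trans ?_ (hb k)
    simp only [norm_div, norm_mul]
    have hp : 0 < ‖poch (σ:ℂ) k‖ := norm_pos_iff.2 (poch_ne _ (nonpole_of_re (by simpa using hσ)) k)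
    have h4 : (0:ℝ) < ‖(k.factorial : ℂ)‖ := by
      rw [Complex.norm_natCast]; exact_mod_cast k.factorial_pos
    gcongr
    rw [poch, poch, norm_prod, norm_prod]
    refine Finset.prod_le_prod (fun _ _ => norm_nonneg _) fun i _ => ?_
    refine le_trans ?_ (Complex.re_le_norm _)
    have : (0:ℝ) ≤ i := i.cast_nonneg
    rw [show (σ:ℂ) + (i:ℂ) = ((σ + i : ℝ) : ℂ) by push_cast; ring, Complex.norm_of_nonneg (by linarith)]
    simp at hN ⊢; linarith

theorem gauss (a b c : ℂ) (h : ∀ n : ℕ, c ≠ -(n : ℂ)) (hre : 0 < (c - a - b).re)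
    (ha : ∀ n : ℕ, c - a ≠ -(n : ℂ)) (hb : ∀ n : ℕ, c - b ≠ -(n : ℂ)) :
    ∑' k : ℕ, poch a k * poch b k / (poch c k * (Nat.factorial k : ℂ)) =
      Complex.Gamma c * Complex.Gamma (c - a - b) / (Complex.Gamma (c - a) * Complex.Gamma (c - b)) := by
  have hd := nonpole_of_re hre
  set S := ∑' k : ℕ, poch a k * poch b k / (poch c k * (Nat.factorial k : ℂ))
  have ht : Tendsto (fun N : ℕ => Complex.GammaSeq c N * Complex.GammaSeq (c - a - b) N /
      (Complex.GammaSeq (c - a) N * Complex.GammaSeq (c - b) N) *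
      ∑' k : ℕ, poch a k * poch b k / (poch (c + (N + 1 : ℕ)) k * (Nat.factorial k : ℂ))) atTop
      (𝓝 (Complex.Gamma c * Complex.Gamma (c - a - b) /
        (Complex.Gamma (c - a) * Complex.Gamma (c - b)) * 1)) := by
    refine Tendsto.mul (Tendsto.div ?_ ?_ ?_) ((tendsto_add_atTop_iff_nat 1).2 (gauss_lim a b c))
    · exact (Complex.GammaSeq_tendsto_Gamma _).mul (Complex.GammaSeq_tendsto_Gamma _)
    · exact (Complex.GammaSeq_tendsto_Gamma _).mul (Complex.GammaSeq_tendsto_Gamma _)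
    · exact mul_ne_zero (Complex.Gamma_ne_zero ha) (Complex.Gamma_ne_zero hb)
  rw [mul_one] at ht
  refine tendsto_nhds_unique (Tendsto.congr' ?_ tendsto_const_nhds) ht
  filter_upwards [eventually_ge_atTop 1] with N hN
  have hN0 : (N : ℂ) ≠ 0 := by exact_mod_cast (by omega : N ≠ 0)
  have e := gauss_iter a b c h hre (N + 1)
  have e1 := poch_ne c h (N + 1)
  have e2 := poch_ne _ hd (N + 1)
  have e3 := poch_ne _ ha (N + 1)
  have e4 := poch_ne _ hb (N + 1)
  have e5 : (N.factorial : ℂ) ≠ 0 := by exact_mod_cast N.factorial_ne_zero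
  have e6 : (N : ℂ) ^ c * (N : ℂ) ^ (c - a - b) = (N : ℂ) ^ (c - a) * (N : ℂ) ^ (c - b) := by
    rw [← Complex.cpow_add _ _ hN0, ← Complex.cpow_add _ _ hN0]; congr 1; ring
  have e7 : (N : ℂ) ^ (c - a) ≠ 0 := by simp [Complex.cpow_eq_zero_iff, hN0]
  have e8 : (N : ℂ) ^ (c - b) ≠ 0 := by simp [Complex.cpow_eq_zero_iff, hN0]
  simp only [GammaSeq_poch]
  set T := ∑' k : ℕ, poch a k * poch b k / (poch (c + (N + 1 : ℕ)) k * (Nat.factorial k : ℂ))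
  have : (N : ℂ) ^ c * N.factorial / poch c (N + 1) * ((N : ℂ) ^ (c - a - b) * N.factorial / poch (c - a - b) (N + 1)) /
      ((N : ℂ) ^ (c - a) * N.factorial / poch (c - a) (N + 1) * ((N : ℂ) ^ (c - b) * N.factorial / poch (c - b) (N + 1)))
      = poch (c - a) (N + 1) * poch (c - b) (N + 1) / (poch c (N + 1) * poch (c - a - b) (N + 1)) := by
    field_simp
    linear_combination e6
  rw [this]
  field_simp
  linear_combination e

noncomputable def hco (a b c : ℂ) (k : ℕ) : ℂ := poch a k * poch b k / (poch c k * (Nat.factorial k : ℂ))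

noncomputable def hS (a b c : ℂ) (z : ℂ) : ℂ := ∑' k : ℕ, hco a b c k * z ^ k

noncomputable def hP (a b c : ℂ) (z : ℂ) : ℂ := (1 - z) ^ (-a) * hS a (c - b) c (z / (z - 1))

noncomputable def hG (a b c : ℂ) (z : ℂ) : ℂ := if z.re < 1 / 2 then hP a b c z else hS a b c z

lemma hS_major (a b c : ℂ) (h : ∀ n : ℕ, c ≠ -(n : ℂ)) {r : ℝ} (h0 : 0 ≤ r) (h1 : r < 1) :
    ∃ u : ℕ → ℝ, Summable u ∧ ∀ k, ∀ w : ℂ, ‖w‖ ≤ r → ‖hco a b c k * w ^ k‖ ≤ u k := by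
  obtain ⟨M, hM, hb⟩ := coef_bound a b c h
  refine ⟨_, (summable_rpow_geom ((a + b - c).re - 1) h0 h1).mul_left M, fun k w hw => ?_⟩
  rw [norm_mul, norm_pow, ← mul_assoc]
  gcongr
  exact hb k

lemma hS_hasSum (a b c : ℂ) (h : ∀ n : ℕ, c ≠ -(n : ℂ)) {z : ℂ} (hz : ‖z‖ < 1) :
    HasSum (fun k => hco a b c k * z ^ k) (hS a b c z) := by
  obtain ⟨u, hu, hb⟩ := hS_major a b c h (norm_nonneg z) hz
  exact (Summable.of_norm_bounded hu fun k => hb k z le_rfl).hasSum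

lemma hS_diff (a b c : ℂ) (h : ∀ n : ℕ, c ≠ -(n : ℂ)) {z : ℂ} (hz : ‖z‖ < 1) :
    DifferentiableAt ℂ (hS a b c) z ∧
      HasSum (fun k : ℕ => hco a b c k * (k * z ^ (k - 1))) (deriv (hS a b c) z) := by
  obtain ⟨r, hr1, hr2⟩ := exists_between hz
  have hr0 : 0 ≤ r := (norm_nonneg z).trans hr1.le
  obtain ⟨u, hu, hb⟩ := hS_major a b c h hr0 hr2
  have h1 : ∀ i : ℕ, DifferentiableOn ℂ (fun w : ℂ => hco a b c i * w ^ i) (Metric.ball 0 r) :=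
    fun i => by fun_prop
  have h3 : ∀ (i : ℕ) (w : ℂ), w ∈ Metric.ball (0:ℂ) r → ‖hco a b c i * w ^ i‖ ≤ u i :=
    fun i w hw => hb i w (by simpa using (mem_ball_zero_iff.1 hw).le)
  have hzm : z ∈ Metric.ball (0:ℂ) r := by simpa using hr1
  refine ⟨(differentiableOn_tsum_of_summable_norm hu h1 Metric.isOpen_ball h3).differentiableAt
    (Metric.isOpen_ball.mem_nhds hzm), ?_⟩
  have H := hasSum_deriv_of_summable_norm hu h1 Metric.isOpen_ball h3 hzm
  refine HasSum.congr_fun H ?_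
  intro k
  simp

lemma hS_contig (a b c : ℂ) (h : ∀ n : ℕ, c ≠ -(n : ℂ)) {z : ℂ} (hz : ‖z‖ < 1) :
    a * hS a (c - b) c z - (1 - z) * deriv (hS a (c - b) c) z
      = a * b / c * hS (a + 1) (c - b) (c + 1) z := by
  have h' : ∀ n : ℕ, c + 1 ≠ -(n : ℂ) := by simpa using shift_nonpole h 1
  have H0 := hS_hasSum a (c - b) c h hz
  have H1 := (hS_diff a (c - b) c h hz).2
  have H2 := hS_hasSum (a + 1) (c - b) (c + 1) h' hz
  have H3 : HasSum (fun k : ℕ => hco a (c - b) c (k + 1) * ((k + 1 : ℕ) * z ^ k))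
      (deriv (hS a (c - b) c) z) := by
    have := (hasSum_nat_add_iff' 1).2 H1
    simpa using this
  have H4 : HasSum (fun k : ℕ => hco a (c - b) c k * (k * z ^ k)) (z * deriv (hS a (c - b) c) z) := by
    refine (H1.mul_left z).congr_fun ?_ |> id
    intro k
    rcases k with _ | k
    · simp
    · simp [pow_succ]; ring
  have H5 := ((H0.mul_left a).sub H3).add H4
  have H6 := H2.mul_left (a * b / c)
  rw [show a * hS a (c - b) c z - (1 - z) * deriv (hS a (c - b) c) z = a * hS a (c - b) c z - deriv (hS a (c - b) c) z + z * deriv (hS a (c - b) c) z by ring]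
  refine H5.unique ?_
  refine HasSum.congr_fun H6 ?_
  intro k
  have e1 := poch_ne c h k
  have e3 : c + k ≠ 0 := fun h0 => h k (by linear_combination h0)
  have e4 : c ≠ 0 := by simpa using h 0
  have e5 : (k.factorial : ℂ) ≠ 0 := by exact_mod_cast k.factorial_ne_zero
  have e6 : (k : ℂ) + 1 ≠ 0 := by exact_mod_cast k.succ_ne_zero
  have e7 : poch (c + 1) k = poch c k * (c + k) / c := by
    rw [eq_div_iff e4, ← poch_shift]; ring
  have e8 := poch_shift a k
  simp only [hco]
  rw [e7, poch_succ', poch_succ', poch_succ', Nat.factorial_succ]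
  push_cast
  field_simp
  linear_combination (-b) * poch (c - b) k * z ^ k * e8

lemma norm_lt_of_re {z : ℂ} (hz : z.re < 1 / 2) : ‖z / (z - 1)‖ < 1 := by
  have hne : z - 1 ≠ 0 := by
    intro h
    have := congrArg Complex.re h
    simp at this; linarith
  rw [norm_div, div_lt_one (norm_pos_iff.2 hne)]
  apply lt_of_pow_lt_pow_left₀ 2 (norm_nonneg _)
  rw [← Complex.normSq_eq_norm_sq, ← Complex.normSq_eq_norm_sq, Complex.normSq_apply, Complex.normSq_apply]
  simp; nlinarith

lemma hP_hasDerivAt (a b c : ℂ) (h : ∀ n : ℕ, c ≠ -(n : ℂ)) {z : ℂ} (hz : z.re < 1 / 2) :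
    HasDerivAt (hP a b c) (a * b / c * hP (a + 1) (b + 1) (c + 1) z) z := by
  have hne : z - 1 ≠ 0 := by
    intro h
    have := congrArg Complex.re h
    simp at this; linarith
  have hne' : 1 - z ≠ 0 := by intro h; exact hne (by linear_combination -h)
  have hp := norm_lt_of_re hz
  have d1 : HasDerivAt (fun z : ℂ => z / (z - 1)) ((1 * (z - 1) - z * 1) / (z - 1) ^ 2) z :=
    (hasDerivAt_id z).div ((hasDerivAt_id z).sub_const 1) hne
  have d2 := ((hS_diff a (c - b) c h hp).1.hasDerivAt).comp z d1
  have d3 : HasDerivAt (fun z : ℂ => (1 - z) ^ (-a)) ((-a) * (1 - z) ^ (-a - 1) * (-1)) z := by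
    have : HasDerivAt (fun z : ℂ => 1 - z) (-1) z := by
      simpa using (hasDerivAt_id z).const_sub 1
    refine this.cpow_const (Or.inl ?_)
    simp; linarith
  have d4 := d3.mul d2
  have key := hS_contig a b c h hp
  refine d4.congr_deriv ?_
  unfold hP
  rw [show c + 1 - (b + 1) = c - b by ring, show -(a + 1) = -a - 1 by ring, mul_left_comm (a * b / c) ((1 - z) ^ (-a - 1)), ← key]
  have e : (1 - z) ^ (-a) = (1 - z) ^ (-a - 1) * (1 - z) := by
    rw [Complex.cpow_sub _ _ hne', Complex.cpow_one]; field_simp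
  simp only [Function.comp_apply, e]
  have e2 : 1 - z / (z - 1) = 1 / (1 - z) := by
    have : z - 1 = -(1 - z) := by ring
    rw [this]; field_simp; ring
  have e3 : (1 * (z - 1) - z * 1) / (z - 1) ^ 2 = - (1 / (1 - z)) * (1 / (1 - z)) := by
    have : (z - 1)^2 = (1 - z)^2 := by ring
    rw [this]; field_simp; ring
  rw [e2, e3]
  field_simp
  ring

lemma isOpen_half : IsOpen {z : ℂ | z.re < 1 / 2} := isOpen_lt Complex.continuous_re continuous_const

lemma hP_iter (a b c : ℂ) (h : ∀ n : ℕ, c ≠ -(n : ℂ)) (n : ℕ) {z : ℂ} (hz : z.re < 1 / 2) :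
    iteratedDeriv n (hP a b c) z = poch a n * poch b n / poch c n * hP (a + n) (b + n) (c + n) z := by
  induction n generalizing z with
  | zero => simp [poch_zero']
  | succ n ih =>
    rw [iteratedDeriv_succ]
    have : iteratedDeriv n (hP a b c) =ᶠ[𝓝 z]
        fun z => poch a n * poch b n / poch c n * hP (a + n) (b + n) (c + n) z := by
      filter_upwards [isOpen_half.mem_nhds hz] with w hw
      exact ih hw
    rw [this.deriv_eq, ((hP_hasDerivAt (a + n) (b + n) (c + n) (shift_nonpole h n) hz).const_mul _).deriv]
    simp only [poch_succ']
    push_cast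
    simp only [← add_assoc]
    rw [← mul_assoc, div_mul_div_comm]
    congr 2
    ring

lemma hS_zero (a b c : ℂ) : hS a b c 0 = 1 := by
  unfold hS
  rw [tsum_eq_single 0]
  · simp [hco, poch_zero']
  · intro k hk; simp [hk]

lemma hP_diffOn (a b c : ℂ) (h : ∀ n : ℕ, c ≠ -(n : ℂ)) :
    DifferentiableOn ℂ (hP a b c) {z : ℂ | z.re < 1 / 2} :=
  fun _ hz => (hP_hasDerivAt a b c h hz).differentiableAt.differentiableWithinAt

lemma pfaff (a b c : ℂ) (h : ∀ n : ℕ, c ≠ -(n : ℂ)) {z : ℂ} (hz : z.re < 1 / 2) (hz1 : ‖z‖ < 1) :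
    hP a b c z = hS a b c z := by
  have hsub : Metric.ball (0:ℂ) (1 / 2) ⊆ {z : ℂ | z.re < 1 / 2} := by
    intro w hw
    exact (Complex.re_le_norm w).trans_lt (by simpa using hw)
  have hloc : ∀ w ∈ Metric.ball (0:ℂ) (1 / 2), hP a b c w = hS a b c w := by
    intro w hw
    have hw1 : ‖w‖ < 1 := by
      have : ‖w‖ < 1 / 2 := by simpa using hw
      linarith
    have H := Complex.hasSum_taylorSeries_on_ball ((hP_diffOn a b c h).mono hsub) hw
    refine H.unique ?_
    refine HasSum.congr_fun (hS_hasSum a b c h hw1) ?_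
    intro n
    rw [hP_iter a b c h n (by simp)]
    have : hP (a + n) (b + n) (c + n) 0 = 1 := by simp [hP, hS_zero]
    rw [this]
    simp only [hco, smul_eq_mul, sub_zero, mul_one]
    rw [div_mul_eq_div_div]
    ring
  have hU : IsOpen (Metric.ball (0:ℂ) 1 ∩ {z : ℂ | z.re < 1 / 2}) := Metric.isOpen_ball.inter isOpen_half
  have hconv : Convex ℝ (Metric.ball (0:ℂ) 1 ∩ {z : ℂ | z.re < 1 / 2}) :=
    (convex_ball _ _).inter (convex_halfSpace_re_lt _)
  have hA1 : AnalyticOnNhd ℂ (hP a b c) (Metric.ball (0:ℂ) 1 ∩ {z : ℂ | z.re < 1 / 2}) :=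
    ((hP_diffOn a b c h).mono inter_subset_right).analyticOnNhd hU
  have hA2 : AnalyticOnNhd ℂ (hS a b c) (Metric.ball (0:ℂ) 1 ∩ {z : ℂ | z.re < 1 / 2}) := by
    refine DifferentiableOn.analyticOnNhd (fun w hw => ?_) hU
    exact (hS_diff a b c h (by simpa using hw.1)).1.differentiableWithinAt
  refine hA1.eqOn_of_preconnected_of_eventuallyEq hA2 hconv.isPreconnected
    (z₀ := 0) (by simp) ?_ ⟨by simpa using hz1, hz⟩
  filter_upwards [Metric.ball_mem_nhds (0:ℂ) (by norm_num : (0:ℝ) < 1 / 2)] with w hw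
  exact hloc w hw

lemma hG_eq_S (a b c : ℂ) (h : ∀ n : ℕ, c ≠ -(n : ℂ)) {z : ℂ} (hz1 : ‖z‖ < 1) :
    hG a b c z = hS a b c z := by
  unfold hG
  split_ifs with hz
  · exact pfaff a b c h hz hz1
  · rfl

lemma hG_eq_P (a b c : ℂ) {z : ℂ} (hz : z.re < 1 / 2) : hG a b c z = hP a b c z := if_pos hz

lemma hG_diff (a b c : ℂ) (h : ∀ n : ℕ, c ≠ -(n : ℂ)) {z : ℂ} (hz : z.re < 1 / 2 ∨ ‖z‖ < 1) :
    DifferentiableAt ℂ (hG a b c) z := by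
  rcases hz with hz | hz
  · refine (hP_hasDerivAt a b c h hz).differentiableAt.congr_of_eventuallyEq ?_
    filter_upwards [isOpen_half.mem_nhds hz] with w hw using hG_eq_P a b c hw
  · refine (hS_diff a b c h hz).1.congr_of_eventuallyEq ?_
    filter_upwards [Metric.isOpen_ball.mem_nhds (show z ∈ Metric.ball (0:ℂ) 1 by simpa using hz)] with w hw
    exact hG_eq_S a b c h (by simpa using hw)

lemma hG_taylor (a b c : ℂ) (h : ∀ n : ℕ, c ≠ -(n : ℂ)) {s x : ℝ} (hs : 0 ≤ s) (hx0 : 0 ≤ x) (hx : x < 1) :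
    HasSum (fun n : ℕ => hco a b c n * (x:ℂ) ^ n * hP (a + n) (b + n) (c + n) (-s)) (hG a b c (x - s)) := by
  have hd : DifferentiableOn ℂ (hG a b c) (Metric.ball (-(s:ℂ)) 1) := by
    intro w hw
    refine (hG_diff a b c h ?_).differentiableWithinAt
    by_contra hcon
    push Not at hcon
    obtain ⟨h1, h2⟩ := hcon
    have h3 : ‖w + s‖ < 1 := by simpa [dist_eq_norm] using hw
    have h4 : ‖w + s‖ ^ 2 < 1 := by nlinarith [norm_nonneg (w + s)]
    have h5 : 1 ≤ ‖w‖ ^ 2 := by nlinarith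
    rw [← Complex.normSq_eq_norm_sq, Complex.normSq_apply] at h4 h5
    simp at h4
    nlinarith
  have H := Complex.hasSum_taylorSeries_on_ball (z := (x:ℂ) - s) hd (by
    rw [Metric.mem_ball, dist_eq_norm, show (x:ℂ) - s - (-(s:ℂ)) = (x:ℂ) by ring, Complex.norm_of_nonneg hx0]
    exact hx)
  refine HasSum.congr_fun H ?_
  intro n
  have hre : (-(s:ℂ)).re < 1 / 2 := by simp; linarith
  have e : iteratedDeriv n (hG a b c) (-(s:ℂ)) = iteratedDeriv n (hP a b c) (-(s:ℂ)) := by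
    apply Filter.EventuallyEq.iteratedDeriv_eq
    filter_upwards [isOpen_half.mem_nhds hre] with w hw using hG_eq_P a b c hw
  rw [e, hP_iter a b c h n hre]
  simp only [hco, smul_eq_mul]
  rw [show (x:ℂ) - s - (-(s:ℂ)) = (x:ℂ) by ring, div_mul_eq_div_div]
  ring

lemma hypF_eq_G (a b c : ℂ) (h : ∀ n : ℕ, c ≠ -(n : ℂ)) {y : ℝ} (hy : y < 1) :
    hypF a b c y = hG a b c y := by
  unfold hypF
  split_ifs with h0
  · rw [hG_eq_S a b c h (by rw [Complex.norm_of_nonneg h0]; exact hy)]; rfl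
  · rw [hG_eq_P a b c (by simp; linarith)]
    unfold hP hS hco
    push_cast
    rfl

lemma hP_neg (a b c : ℂ) {t : ℝ} (ht : t < 1) :
    hP a b c (-((t / (1 - t) : ℝ) : ℂ)) = ((1 - t : ℝ) : ℂ) ^ a * hS a (c - b) c t := by
  unfold hP
  have h1 : 0 < 1 - t := by linarith
  have h1' : (1 - t : ℂ) ≠ 0 := by exact_mod_cast h1.ne'
  have e1 : (1 : ℂ) - -((t / (1 - t) : ℝ) : ℂ) = (((1 - t)⁻¹ : ℝ) : ℂ) := by
    push_cast; field_simp; ring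
  have e2 : -((t / (1 - t) : ℝ) : ℂ) / (-((t / (1 - t) : ℝ) : ℂ) - 1) = t := by
    have : -((t / (1 - t) : ℝ) : ℂ) - 1 = -(1 - t : ℂ)⁻¹ := by push_cast; field_simp; ring
    rw [this]; push_cast; field_simp
  rw [e1, e2]
  congr 1
  rw [Complex.ofReal_inv, Complex.inv_cpow, Complex.cpow_neg, inv_inv]
  rw [Complex.arg_ofReal_of_nonneg h1.le]; exact Real.pi_pos.ne

lemma beta_int {u v : ℂ} (hu : 0 < u.re) (hv : 0 < v.re) :
    IntegrableOn (fun t : ℝ => (t : ℂ) ^ (u - 1) * (1 - (t : ℂ)) ^ (v - 1)) (Ioo 0 1) ∧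
    ∫ t in Ioo (0:ℝ) 1, (t : ℂ) ^ (u - 1) * (1 - (t : ℂ)) ^ (v - 1)
      = Complex.Gamma u * Complex.Gamma v / Complex.Gamma (u + v) := by
  constructor
  · have := Complex.betaIntegral_convergent hu hv
    rw [intervalIntegrable_iff_integrableOn_Ioc_of_le zero_le_one] at this
    exact this.mono_set Ioo_subset_Ioc_self
  · rw [Complex.Gamma_mul_Gamma_eq_betaIntegral hu hv, mul_div_cancel_left₀, Complex.betaIntegral,
      intervalIntegral.integral_of_le zero_le_one, integral_Ioc_eq_integral_Ioo]
    exact Complex.Gamma_ne_zero_of_re_pos (by simp; linarith)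

lemma beta_norm {u v : ℂ} (hu : 0 < u.re) (hv : 0 < v.re) :
    ∫ t in Ioo (0:ℝ) 1, ‖(t : ℂ) ^ (u - 1) * (1 - (t : ℂ)) ^ (v - 1)‖
      = ‖Complex.Gamma (u.re : ℂ) * Complex.Gamma (v.re : ℂ) / Complex.Gamma ((u.re : ℂ) + (v.re : ℂ))‖ := by
  rw [← (beta_int (u := (u.re : ℂ)) (v := (v.re : ℂ)) (by simpa) (by simpa)).2]
  have e : ∫ t in Ioo (0:ℝ) 1, (t : ℂ) ^ ((u.re : ℂ) - 1) * (1 - (t : ℂ)) ^ ((v.re : ℂ) - 1)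
      = ∫ t in Ioo (0:ℝ) 1, ((‖(t : ℂ) ^ (u - 1) * (1 - (t : ℂ)) ^ (v - 1)‖ : ℝ) : ℂ) := by
    refine setIntegral_congr_fun measurableSet_Ioo fun t ht => ?_
    have h1 : 0 < 1 - t := by linarith [ht.2]
    rw [norm_mul, show (1 - (t:ℂ)) = ((1 - t : ℝ) : ℂ) by push_cast; rfl,
      Complex.norm_cpow_eq_rpow_re_of_pos ht.1, Complex.norm_cpow_eq_rpow_re_of_pos h1]
    push_cast
    rw [Complex.ofReal_cpow ht.1.le, Complex.ofReal_cpow h1.le]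
    push_cast
    simp
  rw [e, integral_complex_ofReal]
  rw [Complex.norm_real, Real.norm_eq_abs, abs_of_nonneg]
  exact integral_nonneg fun t => norm_nonneg _

lemma lemmaU (μ A : ℂ) (hμ : 0 < μ.re) (hA : μ.re < A.re) (e : ℕ → ℕ → ℂ) (M L β : ℝ)
    (hβ : μ.re < β) (he : ∀ n k, ‖e n k‖ ≤ M * (((n:ℝ) + 1) ^ L * ((k:ℝ) + 1) ^ (-β)))
    {r : ℝ} (h0 : 0 ≤ r) (h1 : r < 1) :
    ∫ t in Ioo (0:ℝ) 1, (∑' p : ℕ × ℕ, e p.1 p.2 * poch A (p.1 + p.2) /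
        ((p.1.factorial : ℂ) * (p.2.factorial : ℂ)) * ((r * (1 - t) : ℝ) : ℂ) ^ p.1 * (t : ℂ) ^ p.2)
          * ((t : ℂ) ^ (μ - 1) * (1 - (t : ℂ)) ^ (A - μ - 1))
      = Complex.Gamma μ * Complex.Gamma (A - μ) / Complex.Gamma A *
        ∑' n : ℕ, poch (A - μ) n / (n.factorial : ℂ) * (r : ℂ) ^ n *
          ∑' k : ℕ, e n k * poch μ k / (k.factorial : ℂ) := by
  have hA0 : 0 < A.re := hμ.trans hA
  have hAμ : 0 < (A - μ).re := by simp; linarith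
  have nA := nonpole_of_re hA0
  have nμ := nonpole_of_re hμ
  have nAμ := nonpole_of_re hAμ
  set co : ℕ × ℕ → ℂ := fun p => e p.1 p.2 * poch A (p.1 + p.2) /
        ((p.1.factorial : ℂ) * (p.2.factorial : ℂ)) * (r : ℂ) ^ p.1 with hco
  set F : ℕ × ℕ → ℝ → ℂ := fun p t => co p * ((t : ℂ) ^ ((μ + p.2) - 1) * (1 - (t : ℂ)) ^ ((A - μ + p.1) - 1)) with hF
  have hk : ∀ k : ℕ, 0 < (μ + k).re := fun k => by simp; positivity
  have hn : ∀ n : ℕ, 0 < (A - μ + n).re := fun n => by simp at hAμ ⊢; positivity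
  have hint : ∀ p, Integrable (F p) (volume.restrict (Ioo 0 1)) := fun p =>
    ((beta_int (hk p.2) (hn p.1)).1).const_mul _
  have hval : ∀ p, ∫ t in Ioo (0:ℝ) 1, F p t = Complex.Gamma μ * Complex.Gamma (A - μ) / Complex.Gamma A *
      (poch (A - μ) p.1 / (p.1.factorial : ℂ) * (r : ℂ) ^ p.1 * (e p.1 p.2 * poch μ p.2 / (p.2.factorial : ℂ))) := by
    intro p
    simp only [hF]
    rw [integral_const_mul, (beta_int (hk p.2) (hn p.1)).2]
    rw [show μ + p.2 + (A - μ + p.1) = A + ((p.1 + p.2 : ℕ) : ℂ) by push_cast; ring,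
      Gamma_add_nat' _ nA, Gamma_add_nat' _ nμ, Gamma_add_nat' _ nAμ]
    have := poch_ne A nA (p.1 + p.2)
    have e5 : (p.1.factorial : ℂ) ≠ 0 := by exact_mod_cast p.1.factorial_ne_zero
    have e6 : (p.2.factorial : ℂ) ≠ 0 := by exact_mod_cast p.2.factorial_ne_zero
    have e7 := Complex.Gamma_ne_zero_of_re_pos hA0
    simp only [hco]
    field_simp
  have hsum : Summable fun p => ∫ t in Ioo (0:ℝ) 1, ‖F p t‖ := by
    set p0 : ℂ := (μ.re : ℂ) with hp0
    set a0 : ℂ := ((A - μ).re : ℂ) with ha0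
    set s0 : ℂ := (A.re : ℂ) with hs0
    have rs : 0 < s0.re := by simpa [hs0]
    have rp : 0 < p0.re := by simpa [hp0]
    have ra : 0 < a0.re := by simp only [ha0, ofReal_re]; exact hAμ
    obtain ⟨M1, hM1, b1⟩ := poch_UB p0
    obtain ⟨M2, hM2, b2⟩ := poch_UB a0
    obtain ⟨M3, hM3, b3⟩ := poch_LB s0 (nonpole_of_re rs)
    obtain ⟨M4, hM4, b4⟩ := poch_UB A
    have S1 := summable_rpow_geom (L + (A - μ).re - 1) h0 h1
    have S2 : Summable fun k : ℕ => ((k:ℝ) + 1) ^ (μ.re - β - 1) := summable_rpow_succ (by linarith)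
    have S3 := S1.mul_of_nonneg S2 (fun n => by simp only [Pi.zero_apply]; positivity) (fun n => by simp only [Pi.zero_apply]; positivity)
    set G := ‖Complex.Gamma p0 * Complex.Gamma a0 / Complex.Gamma s0‖ with hG
    refine Summable.of_nonneg_of_le (fun p => integral_nonneg fun t => norm_nonneg _) (fun p => ?_)
      (S3.mul_left (M * M4 * M1 * M2 * M3 * G))
    obtain ⟨n, k⟩ := p
    have i1 : ∫ t in Ioo (0:ℝ) 1, ‖F (n, k) t‖ = ‖co (n, k)‖ * (G * (‖poch p0 k‖ * ‖poch a0 n‖ * ‖poch s0 (n + k)‖⁻¹)) := by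
      simp only [hF, norm_mul (co (n, k))]
      rw [integral_const_mul, beta_norm (hk k) (hn n)]
      rw [show ((μ + k).re : ℂ) = p0 + k by simp [hp0], show ((A - μ + n).re : ℂ) = a0 + n by simp [ha0],
        show p0 + k + (a0 + n) = s0 + ((n + k : ℕ) : ℂ) by simp [hp0, ha0, hs0]; ring,
        Gamma_add_nat' _ (nonpole_of_re rs), Gamma_add_nat' _ (nonpole_of_re rp), Gamma_add_nat' _ (nonpole_of_re ra)]
      simp only [hG, norm_mul, norm_inv, mul_inv, div_eq_mul_inv]
      ring
    rw [i1]
    have i2 : ‖co (n, k)‖ = ‖e n k‖ * ‖poch A (n + k)‖ * ((n.factorial : ℝ)⁻¹ * (k.factorial : ℝ)⁻¹) * r ^ n := by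
      simp only [hco, norm_mul, norm_div, norm_pow, Complex.norm_natCast, Complex.norm_of_nonneg h0]
      rw [div_eq_mul_inv, mul_inv]
    rw [i2]
    have q1 : (0:ℝ) < (n.factorial : ℝ) := by exact_mod_cast n.factorial_pos
    have q2 : (0:ℝ) < (k.factorial : ℝ) := by exact_mod_cast k.factorial_pos
    have q3 : (0:ℝ) < ((n + k).factorial : ℝ) := by exact_mod_cast (n + k).factorial_pos
    have hM0 : 0 ≤ M * (((n:ℝ) + 1) ^ L * ((k:ℝ) + 1) ^ (-β)) := (norm_nonneg _).trans (he n k)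
    calc _ ≤ (M * (((n:ℝ) + 1) ^ L * ((k:ℝ) + 1) ^ (-β))) * (M4 * ((n + k).factorial * (((n + k : ℕ):ℝ) + 1) ^ (A.re - 1)))
          * ((n.factorial : ℝ)⁻¹ * (k.factorial : ℝ)⁻¹) * r ^ n * (G * ((M1 * (k.factorial * ((k:ℝ) + 1) ^ (p0.re - 1))) *
            (M2 * (n.factorial * ((n:ℝ) + 1) ^ (a0.re - 1))) * (M3 * (((n + k).factorial : ℝ)⁻¹ * (((n + k : ℕ):ℝ) + 1) ^ (1 - s0.re))))) := by
          gcongr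
          · exact he n k
          · exact b4 _
          · exact b1 _
          · exact b2 _
          · exact b3 _
      _ = _ := by
          have z1 : (0:ℝ) < (n:ℝ) + 1 := by positivity
          have z2 : (0:ℝ) < (k:ℝ) + 1 := by positivity
          have z3 : (0:ℝ) < ((n + k : ℕ):ℝ) + 1 := by positivity
          have w1 : ((n:ℝ) + 1) ^ (L + (A - μ).re - 1) = ((n:ℝ) + 1) ^ L * ((n:ℝ) + 1) ^ (a0.re - 1) := by
            rw [← Real.rpow_add z1]; congr 1; simp [ha0]; ring
          have w2 : ((k:ℝ) + 1) ^ (μ.re - β - 1) = ((k:ℝ) + 1) ^ (-β) * ((k:ℝ) + 1) ^ (p0.re - 1) := by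
            rw [← Real.rpow_add z2]; congr 1; simp [hp0]; ring
          have w3 : (((n + k : ℕ):ℝ) + 1) ^ (A.re - 1) * (((n + k : ℕ):ℝ) + 1) ^ (1 - s0.re) = 1 := by
            rw [← Real.rpow_add z3]; simp [hs0]
          have w4 : (n.factorial : ℝ) * (n.factorial : ℝ)⁻¹ = 1 := mul_inv_cancel₀ q1.ne'
          have w5 : (k.factorial : ℝ) * (k.factorial : ℝ)⁻¹ = 1 := mul_inv_cancel₀ q2.ne'
          have w6 : ((n + k).factorial : ℝ) * ((n + k).factorial : ℝ)⁻¹ = 1 := mul_inv_cancel₀ q3.ne'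
          simp only [w1, w2]
          calc _ = M * M4 * M1 * M2 * M3 * G * (((n:ℝ) + 1) ^ L * ((n:ℝ) + 1) ^ (a0.re - 1) * r ^ n *
                (((k:ℝ) + 1) ^ (-β) * ((k:ℝ) + 1) ^ (p0.re - 1))) *
                ((((n + k : ℕ):ℝ) + 1) ^ (A.re - 1) * (((n + k : ℕ):ℝ) + 1) ^ (1 - s0.re)) *
                ((n.factorial : ℝ) * (n.factorial : ℝ)⁻¹) * ((k.factorial : ℝ) * (k.factorial : ℝ)⁻¹) *
                (((n + k).factorial : ℝ) * ((n + k).factorial : ℝ)⁻¹) := by ring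
            _ = _ := by rw [w3, w4, w5, w6]; ring
  have H := hasSum_integral_of_summable_integral_norm hint hsum
  have e1 : ∫ t in Ioo (0:ℝ) 1, (∑' p : ℕ × ℕ, e p.1 p.2 * poch A (p.1 + p.2) /
        ((p.1.factorial : ℂ) * (p.2.factorial : ℂ)) * ((r * (1 - t) : ℝ) : ℂ) ^ p.1 * (t : ℂ) ^ p.2)
          * ((t : ℂ) ^ (μ - 1) * (1 - (t : ℂ)) ^ (A - μ - 1)) = ∫ t in Ioo (0:ℝ) 1, ∑' p, F p t := by
    refine setIntegral_congr_fun measurableSet_Ioo fun t ht => ?_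
    rw [← tsum_mul_right]
    refine tsum_congr fun p => ?_
    have t0 : (t : ℂ) ≠ 0 := by exact_mod_cast ht.1.ne'
    have t1 : (1 - t : ℂ) ≠ 0 := by
      have : (1 - t : ℝ) ≠ 0 := by linarith [ht.2]
      exact_mod_cast this
    simp only [hF, hco]
    rw [show μ + p.2 - 1 = (μ - 1) + p.2 by ring, show A - μ + p.1 - 1 = (A - μ - 1) + p.1 by ring,
      Complex.cpow_add _ _ t0, Complex.cpow_add _ _ t1, Complex.cpow_natCast, Complex.cpow_natCast]
    push_cast
    rw [mul_pow]
    ring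
  rw [e1, ← H.tsum_eq, H.summable.tsum_prod, ← tsum_mul_left]
  refine tsum_congr fun n => ?_
  rw [← tsum_mul_left, ← tsum_mul_left]
  exact tsum_congr fun k => hval (n, k)

lemma pair_sum (f : ℕ → ℂ) {u t : ℝ} (hu : 0 ≤ u) (ht : 0 ≤ t)
    (hs : Summable fun K => ‖f K‖ * (u + t) ^ K) :
    Summable (fun p : ℕ × ℕ => f (p.1 + p.2) * ((p.1 + p.2).choose p.1 : ℂ) * (u : ℂ) ^ p.1 * (t : ℂ) ^ p.2) ∧
    ∑' p : ℕ × ℕ, f (p.1 + p.2) * ((p.1 + p.2).choose p.1 : ℂ) * (u : ℂ) ^ p.1 * (t : ℂ) ^ p.2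
      = ∑' K, f K * ((u + t : ℝ) : ℂ) ^ K := by
  set F : ℕ × ℕ → ℂ := fun p => f (p.1 + p.2) * ((p.1 + p.2).choose p.1 : ℂ) * (u : ℂ) ^ p.1 * (t : ℂ) ^ p.2 with hF
  set E := Finset.HasAntidiagonal.sigmaAntidiagonalEquivProd (A := ℕ) with hE
  have S : Summable F := by
    apply Summable.of_norm
    rw [← E.summable_iff]
    refine (summable_sigma_of_nonneg (f := (fun a => ‖F a‖) ∘ E) (fun _ => norm_nonneg _)).2 ?_
    refine ⟨fun K => (hasSum_fintype _).summable, ?_⟩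
    refine hs.congr fun K => ?_
    rw [tsum_fintype, Commute.add_pow' (Commute.all u t), Finset.mul_sum,
      ← Finset.sum_coe_sort (Finset.HasAntidiagonal.antidiagonal K)]
    refine Finset.sum_congr rfl fun p _ => ?_
    obtain ⟨⟨n, k⟩, hp⟩ := p
    rw [Finset.HasAntidiagonal.mem_antidiagonal] at hp
    subst hp
    simp [hE, hF, abs_of_nonneg hu, abs_of_nonneg ht, mul_assoc]
  refine ⟨S, ?_⟩
  rw [← E.tsum_eq]
  refine (Summable.tsum_sigma' (f := F ∘ E) (fun K => (hasSum_fintype _).summable) (E.summable_iff.2 S)).trans ?_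
  refine tsum_congr fun K => ?_
  push_cast
  rw [tsum_fintype, Commute.add_pow' (Commute.all (u:ℂ) (t:ℂ)), Finset.mul_sum,
      ← Finset.sum_coe_sort (Finset.HasAntidiagonal.antidiagonal K)]
  refine Finset.sum_congr rfl fun p _ => ?_
  obtain ⟨⟨n, k⟩, hp⟩ := p
  rw [Finset.HasAntidiagonal.mem_antidiagonal] at hp
  subst hp
  simp [hE, hF, mul_assoc]

lemma choose_eqR (n k : ℕ) : ((n + k).choose n : ℝ) = ((n + k).factorial : ℝ) / ((n.factorial : ℝ) * (k.factorial : ℝ)) := by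
  have h := Nat.add_choose_mul_factorial_mul_factorial n k
  have e5 : (n.factorial : ℝ) ≠ 0 := by exact_mod_cast n.factorial_ne_zero
  have e6 : (k.factorial : ℝ) ≠ 0 := by exact_mod_cast k.factorial_ne_zero
  rw [eq_div_iff (mul_ne_zero e5 e6), ← h, Nat.choose_symm_add]
  push_cast; ring

lemma choose_eq (n k : ℕ) : ((n + k).choose n : ℂ) = ((n + k).factorial : ℂ) / ((n.factorial : ℂ) * (k.factorial : ℂ)) := by
  have h := congrArg (fun y : ℝ => (y : ℂ)) (choose_eqR n k)
  push_cast at h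
  exact h

lemma pair_summable (A : ℂ) (e : ℕ → ℕ → ℂ) (M L β : ℝ) (hβ : 0 < β)
    (he : ∀ n k, ‖e n k‖ ≤ M * (((n:ℝ) + 1) ^ L * ((k:ℝ) + 1) ^ (-β)))
    {u t : ℝ} (hu : 0 ≤ u) (ht : 0 ≤ t) (hut : u + t < 1) :
    Summable fun p : ℕ × ℕ => e p.1 p.2 * poch A (p.1 + p.2) /
        ((p.1.factorial : ℂ) * (p.2.factorial : ℂ)) * (u : ℂ) ^ p.1 * (t : ℂ) ^ p.2 := by
  obtain ⟨M4, hM4, b4⟩ := poch_UB A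
  have S := (summable_rpow_geom (|L| + (A.re - 1)) (add_nonneg hu ht) hut).mul_left (|M| * M4)
  set f : ℕ → ℂ := fun K => ((|M| * M4 * ((K:ℝ) + 1) ^ (|L| + (A.re - 1)) : ℝ) : ℂ) with hf
  have nf : ∀ K, ‖f K‖ = |M| * M4 * ((K:ℝ) + 1) ^ (|L| + (A.re - 1)) := fun K => by
    rw [hf]; exact Complex.norm_of_nonneg (by positivity)
  have S2 := (pair_sum f hu ht (by simpa only [nf, mul_assoc] using S)).1.norm
  refine Summable.of_norm_bounded S2 fun p => ?_
  obtain ⟨n, k⟩ := p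
  simp only [norm_mul, norm_div, norm_pow, Complex.norm_natCast, nf]
  have hch : ((n + k).choose n : ℝ) = ((n + k).factorial : ℝ) / ((n.factorial : ℝ) * (k.factorial : ℝ)) := choose_eqR n k
  rw [hch, ← mul_div_assoc]
  refine mul_le_mul_of_nonneg_right (mul_le_mul_of_nonneg_right (div_le_div_of_nonneg_right ?_ (by positivity)) (by positivity)) (by positivity)
  have z : (0:ℝ) < ((n + k : ℕ):ℝ) + 1 := by positivity
  have k1 : ((n:ℝ) + 1) ^ L ≤ (((n + k : ℕ):ℝ) + 1) ^ |L| := by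
    calc ((n:ℝ) + 1) ^ L ≤ ((n:ℝ) + 1) ^ |L| :=
          Real.rpow_le_rpow_of_exponent_le (by linarith [Nat.cast_nonneg (α := ℝ) n]) (le_abs_self L)
      _ ≤ _ := by gcongr; omega
  have k2 : ((k:ℝ) + 1) ^ (-β) ≤ 1 := by
    apply Real.rpow_le_one_of_one_le_of_nonpos
    · linarith [Nat.cast_nonneg (α := ℝ) k]
    · linarith
  calc ‖e n k‖ * ‖poch A (n + k)‖ ≤ (|M| * ((((n + k : ℕ):ℝ) + 1) ^ |L| * 1)) *
        (M4 * ((n + k).factorial * (((n + k : ℕ):ℝ) + 1) ^ (A.re - 1))) := by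
        gcongr
        · refine (he n k).trans ?_
          gcongr
          exact le_abs_self M
        · exact b4 _
    _ = _ := by rw [Real.rpow_add z]; ring

lemma cv (g : ℝ → ℂ) (μ : ℂ) (x l : ℝ) (hl : 0 < l) :
    ∫ y in Iio x, g y * ((x - y : ℝ) : ℂ) ^ (μ - 1) =
      (l : ℂ) ^ μ * ∫ t in Ioo (0:ℝ) 1, g (x - l * (t / (1 - t))) *
        ((t : ℂ) ^ (μ - 1) * (1 - (t : ℂ)) ^ (-μ - 1)) := by
  have him : (fun t : ℝ => x - l * (t / (1 - t))) '' (Ioo 0 1) = Iio x := by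
    ext y
    constructor
    · rintro ⟨t, ht, rfl⟩
      have h1 : 0 < 1 - t := by linarith [ht.2]
      have : 0 < l * (t / (1 - t)) := mul_pos hl (div_pos ht.1 h1)
      simp only [mem_Iio]; linarith
    · intro hy
      have hy' : 0 < x - y := by simp at hy; linarith
      have h2 : 0 < l + (x - y) := by linarith
      refine ⟨(x - y) / (l + (x - y)), ⟨by positivity, by rw [div_lt_one h2]; linarith⟩, ?_⟩
      have : 1 - (x - y) / (l + (x - y)) = l / (l + (x - y)) := by field_simp; ring
      simp only [this]
      field_simp
      ring
  have hinj : InjOn (fun t : ℝ => x - l * (t / (1 - t))) (Ioo 0 1) := by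
    intro s hs t ht hst
    have h1 : 0 < 1 - t := by linarith [ht.2]
    have h2 : 0 < 1 - s := by linarith [hs.2]
    have : s / (1 - s) = t / (1 - t) := by
      have h3 : l * (s / (1 - s)) = l * (t / (1 - t)) := by simp only at hst; linarith
      exact mul_left_cancel₀ hl.ne' h3
    rw [div_eq_div_iff h2.ne' h1.ne'] at this
    linarith
  have hder : ∀ t ∈ Ioo (0:ℝ) 1, HasDerivWithinAt (fun t : ℝ => x - l * (t / (1 - t))) (-(l / (1 - t) ^ 2)) (Ioo 0 1) t := by
    intro t ht
    have h1 : 1 - t ≠ 0 := by linarith [ht.2]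
    have d := (((hasDerivAt_id t).div ((hasDerivAt_id t).const_sub 1) h1).const_mul l).const_sub x
    refine (d.congr_deriv ?_).hasDerivWithinAt
    simp
    field_simp
  rw [← him, integral_image_eq_integral_abs_deriv_smul measurableSet_Ioo hder hinj, ← integral_const_mul]
  refine setIntegral_congr_fun measurableSet_Ioo fun t ht => ?_
  have h1 : 0 < 1 - t := by linarith [ht.2]
  have h1' : ((1 - t : ℝ) : ℂ) ≠ 0 := by exact_mod_cast h1.ne'
  have hlc : (l : ℂ) ≠ 0 := by exact_mod_cast hl.ne'
  simp only [abs_neg, Complex.real_smul]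
  rw [abs_of_pos (by positivity), show x - (x - l * (t / (1 - t))) = l * (t * (1 - t)⁻¹) by rw [div_eq_mul_inv]; ring,
    show (1 - (t:ℂ)) = ((1 - t : ℝ) : ℂ) by push_cast; rfl]
  rw [Complex.ofReal_mul l, Complex.mul_cpow_ofReal_nonneg hl.le (by have := ht.1; positivity),
    Complex.ofReal_mul t, Complex.mul_cpow_ofReal_nonneg ht.1.le (by positivity),
    Complex.ofReal_inv, Complex.inv_cpow _ _ (by rw [Complex.arg_ofReal_of_nonneg h1.le]; exact Real.pi_pos.ne),
    show -μ - 1 = -(μ - 1) - (2 : ℕ) by push_cast; ring, Complex.cpow_sub (-(μ - 1)) _ h1', Complex.cpow_neg,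
    Complex.cpow_natCast, Complex.ofReal_div, Complex.ofReal_pow]
  have : (l : ℂ) ^ μ = (l : ℂ) ^ (μ - 1) * l := by
    rw [Complex.cpow_sub _ _ hlc, Complex.cpow_one]; field_simp
  rw [this]
  field_simp

lemma bound_neg (B C : ℂ) (hC : ∀ n : ℕ, C ≠ -(n : ℂ)) : ∃ M : ℝ, ∀ n k : ℕ,
    ‖poch (C - B) (n + k) / poch C (n + k)‖ ≤ M * (((n:ℝ) + 1) ^ |-B.re| * ((k:ℝ) + 1) ^ (-B.re)) := by
  obtain ⟨M1, hM1, b1⟩ := poch_UB (C - B)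
  obtain ⟨M2, hM2, b2⟩ := poch_LB C hC
  refine ⟨M1 * M2, fun n k => ?_⟩
  have q3 : (0:ℝ) < ((n + k).factorial : ℝ) := by exact_mod_cast (n + k).factorial_pos
  have z3 : (0:ℝ) < ((n + k : ℕ):ℝ) + 1 := by positivity
  rw [norm_div, div_eq_mul_inv]
  calc _ ≤ (M1 * ((n + k).factorial * (((n + k : ℕ):ℝ) + 1) ^ ((C - B).re - 1))) *
        (M2 * (((n + k).factorial : ℝ)⁻¹ * (((n + k : ℕ):ℝ) + 1) ^ (1 - C.re))) := by
        gcongr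
        · exact b1 _
        · exact b2 _
    _ = M1 * M2 * (((n + k : ℕ):ℝ) + 1) ^ (-B.re) := by
        have w : (((n + k : ℕ):ℝ) + 1) ^ (-B.re) = (((n + k : ℕ):ℝ) + 1) ^ ((C - B).re - 1) * (((n + k : ℕ):ℝ) + 1) ^ (1 - C.re) := by
          rw [← Real.rpow_add z3]; congr 1; simp
        rw [w]; field_simp
    _ ≤ _ := by
        gcongr
        exact peetre n k _

lemma bound_pos (B C : ℂ) (hC : ∀ n : ℕ, C ≠ -(n : ℂ)) : ∃ M L : ℝ, ∀ n k : ℕ,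
    ‖poch (C - B) k * poch B n / poch C (n + k)‖ ≤ M * (((n:ℝ) + 1) ^ L * ((k:ℝ) + 1) ^ (-B.re)) := by
  obtain ⟨M1, hM1, b1⟩ := poch_UB (C - B)
  obtain ⟨M3, hM3, b3⟩ := poch_UB B
  obtain ⟨M2, hM2, b2⟩ := poch_LB C hC
  refine ⟨M1 * M2 * M3, B.re - 1 + |1 - C.re|, fun n k => ?_⟩
  have q3 : (0:ℝ) < ((n + k).factorial : ℝ) := by exact_mod_cast (n + k).factorial_pos
  have z3 : (0:ℝ) < ((n + k : ℕ):ℝ) + 1 := by positivity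
  have z1 : (0:ℝ) < (n:ℝ) + 1 := by positivity
  have z2 : (0:ℝ) < (k:ℝ) + 1 := by positivity
  have hf : (k.factorial : ℝ) * n.factorial * ((n + k).factorial : ℝ)⁻¹ ≤ 1 := by
    rw [← div_eq_mul_inv, div_le_one q3]
    have := Nat.le_of_dvd (Nat.factorial_pos _) (Nat.factorial_mul_factorial_dvd_factorial_add n k)
    rw [mul_comm] at this
    exact_mod_cast this
  rw [norm_div, div_eq_mul_inv, norm_mul]
  calc _ ≤ (M1 * (k.factorial * ((k:ℝ) + 1) ^ ((C - B).re - 1))) * (M3 * (n.factorial * ((n:ℝ) + 1) ^ (B.re - 1))) *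
        (M2 * (((n + k).factorial : ℝ)⁻¹ * (((n + k : ℕ):ℝ) + 1) ^ (1 - C.re))) := by
        gcongr
        · exact b1 _
        · exact b3 _
        · exact b2 _
    _ = M1 * M2 * M3 * ((k.factorial : ℝ) * n.factorial * ((n + k).factorial : ℝ)⁻¹) * (((k:ℝ) + 1) ^ ((C - B).re - 1) *
         ((n:ℝ) + 1) ^ (B.re - 1) * (((n + k : ℕ):ℝ) + 1) ^ (1 - C.re)) := by ring
    _ ≤ M1 * M2 * M3 * 1 * (((k:ℝ) + 1) ^ ((C - B).re - 1) *
         ((n:ℝ) + 1) ^ (B.re - 1) * (((n:ℝ) + 1) ^ |1 - C.re| * ((k:ℝ) + 1) ^ (1 - C.re))) := by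
        gcongr
        exact peetre n k _
    _ = _ := by
        rw [Real.rpow_add z1, show -B.re = ((C - B).re - 1) + (1 - C.re) by simp, Real.rpow_add z2]
        ring

lemma main_neg (A B C μ : ℂ) (hA : μ.re < A.re) (hB : μ.re < B.re) (hμ : 0 < μ.re)
    (h1 : ∀ n : ℕ, C ≠ -(n : ℂ)) (h2 : ∀ n : ℕ, C - μ ≠ -(n : ℂ)) (x : ℝ) (hx : x < 0) :
    ∫ y in Iio x, hypF A B C y * ((x - y : ℝ) : ℂ) ^ (μ - 1)
      = Complex.Gamma μ * (Complex.Gamma (A - μ) / Complex.Gamma A * (Complex.Gamma (B - μ) / Complex.Gamma B) *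
        (Complex.Gamma C / Complex.Gamma (C - μ)) * hypF (A - μ) (B - μ) (C - μ) x) := by
  have hl : 0 < 1 - x := by linarith
  have hlc : ((1 - x : ℝ) : ℂ) ≠ 0 := by exact_mod_cast hl.ne'
  set q : ℝ := x / (x - 1) with hq
  have hx1 : x - 1 ≠ 0 := by linarith
  have q0 : 0 < q := div_pos_of_neg_of_neg hx (by linarith)
  have hq1 : 1 - q = 1 / (1 - x) := by rw [hq]; field_simp; ring
  have q1 : q < 1 := by have : 0 < 1 / (1 - x) := by positivity
                        linarith
  have hA0 : 0 < A.re := hμ.trans hA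
  have hB0 : 0 < B.re := hμ.trans hB
  have hBμ : 0 < (B - μ).re := by simp; linarith
  obtain ⟨M, hM⟩ := bound_neg B C h1
  have U := lemmaU μ A hμ hA (fun n k => poch (C - B) (n + k) / poch C (n + k)) M _ B.re hB hM q0.le q1
  rw [cv _ μ x (1 - x) hl]
  have e1 : ∫ t in Ioo (0:ℝ) 1, hypF A B C (x - (1 - x) * (t / (1 - t))) *
        ((t : ℂ) ^ (μ - 1) * (1 - (t : ℂ)) ^ (-μ - 1)) =
      ((1 - x : ℝ) : ℂ) ^ (-A) * ∫ t in Ioo (0:ℝ) 1, (∑' p : ℕ × ℕ, poch (C - B) (p.1 + p.2) / poch C (p.1 + p.2) * poch A (p.1 + p.2) /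
        ((p.1.factorial : ℂ) * (p.2.factorial : ℂ)) * ((q * (1 - t) : ℝ) : ℂ) ^ p.1 * (t : ℂ) ^ p.2)
          * ((t : ℂ) ^ (μ - 1) * (1 - (t : ℂ)) ^ (A - μ - 1)) := by
    rw [← integral_const_mul]
    refine setIntegral_congr_fun measurableSet_Ioo fun t ht => ?_
    have t1 : 0 < 1 - t := by linarith [ht.2]
    have t0 := ht.1
    have t1' : (1 - (t:ℂ)) ≠ 0 := by
      have : (1 - t) ≠ 0 := t1.ne'
      exact_mod_cast this
    have hy : x - (1 - x) * (t / (1 - t)) = (x - t) / (1 - t) := by field_simp; ring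
    have hy0 : (x - t) / (1 - t) < 0 := div_neg_of_neg_of_pos (by linarith) t1
    have hs : q * (1 - t) + t < 1 := by nlinarith
    have P := (pair_sum (hco A (C - B) C) (u := q * (1 - t)) (t := t) (by positivity) t0.le (by
      have hnn : 0 ≤ q * (1 - t) + t := by positivity
      have := (hS_hasSum A (C - B) C h1 (z := ((q * (1 - t) + t : ℝ) : ℂ)) (by
        rw [Complex.norm_of_nonneg hnn]; exact hs)).summable.norm
      simpa only [norm_mul, norm_pow, Complex.norm_of_nonneg hnn] using this)).2
    have P' : ∑' p : ℕ × ℕ, poch (C - B) (p.1 + p.2) / poch C (p.1 + p.2) * poch A (p.1 + p.2) /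
        ((p.1.factorial : ℂ) * (p.2.factorial : ℂ)) * ((q * (1 - t) : ℝ) : ℂ) ^ p.1 * (t : ℂ) ^ p.2
        = ∑' K, hco A (C - B) C K * ((q * (1 - t) + t : ℝ) : ℂ) ^ K := by
      rw [← P]
      refine tsum_congr fun p => ?_
      have e5 : ((p.1 + p.2).factorial : ℂ) ≠ 0 := by exact_mod_cast (p.1 + p.2).factorial_ne_zero
      congr 2
      rw [choose_eq, hco]
      field_simp
    rw [P', hy, hypF, if_neg (not_le.2 hy0)]
    have g1 : (1 - (x - t) / (1 - t)) = (1 - x) * (1 - t)⁻¹ := by field_simp; ring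
    have g2 : (x - t) / (1 - t) / ((x - t) / (1 - t) - 1) = q * (1 - t) + t := by
      have : (x - t) / (1 - t) - 1 = (x - 1) / (1 - t) := by field_simp; ring
      rw [this, hq]; field_simp; ring
    rw [g1, g2, Complex.ofReal_mul, Complex.mul_cpow_ofReal_nonneg hl.le (by positivity), Complex.ofReal_inv,
      Complex.inv_cpow _ _ (by rw [Complex.arg_ofReal_of_nonneg t1.le]; exact Real.pi_pos.ne), Complex.cpow_neg ((1 - t : ℝ) : ℂ),
      inv_inv, show A - μ - 1 = A + (-μ - 1) by ring, Complex.cpow_add _ _ t1']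
    simp only [hco]
    push_cast
    ring
  rw [e1, U]
  have in1 : ∀ n : ℕ, ∑' k : ℕ, poch (C - B) (n + k) / poch C (n + k) * poch μ k / (k.factorial : ℂ)
      = Complex.Gamma C * Complex.Gamma (B - μ) / (Complex.Gamma (C - μ) * Complex.Gamma B) * (poch (C - B) n / poch (C - μ) n) := by
    intro n
    have g := gauss μ (C - B + n) (C + n) (shift_nonpole h1 n) (by
      rw [show C + n - μ - (C - B + n) = B - μ by ring]; exact hBμ) (by
      rw [show C + n - μ = C - μ + n by ring]; exact shift_nonpole h2 n) (by
      rw [show C + n - (C - B + n) = B by ring]; exact nonpole_of_re hB0)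
    rw [show C + n - μ - (C - B + n) = B - μ by ring, show C + n - μ = C - μ + n by ring,
      show C + n - (C - B + n) = B by ring, Gamma_add_nat' _ h1, Gamma_add_nat' _ h2] at g
    have e9 := poch_ne C h1 n
    calc _ = poch (C - B) n / poch C n * ∑' k : ℕ, poch μ k * poch (C - B + n) k / (poch (C + n) k * (k.factorial : ℂ)) := by
          rw [← tsum_mul_left]
          refine tsum_congr fun k => ?_
          rw [poch_add', poch_add']
          have e6 : (k.factorial : ℂ) ≠ 0 := by exact_mod_cast k.factorial_ne_zero
          have e8 := poch_ne (C + n) (shift_nonpole h1 n) k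
          field_simp
      _ = _ := by
          rw [g]
          have := poch_ne (C - μ) h2 n
          have := Complex.Gamma_ne_zero h2
          have := Complex.Gamma_ne_zero_of_re_pos hB0
          field_simp
  simp only [in1]
  rw [hypF, if_neg (not_le.2 hx), show C - μ - (B - μ) = C - B by ring, show -(A - μ) = μ + -A by ring,
    Complex.cpow_add _ _ hlc, ← hq]
  have : ∀ n : ℕ, poch (A - μ) n / (n.factorial : ℂ) * (q : ℂ) ^ n * (Complex.Gamma C * Complex.Gamma (B - μ) / (Complex.Gamma (C - μ) * Complex.Gamma B) * (poch (C - B) n / poch (C - μ) n))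
     = Complex.Gamma C * Complex.Gamma (B - μ) / (Complex.Gamma (C - μ) * Complex.Gamma B) *
      (poch (A - μ) n * poch (C - B) n / (poch (C - μ) n * (n.factorial : ℂ)) * (q : ℂ) ^ n) := by
    intro n
    have e6 : (n.factorial : ℂ) ≠ 0 := by exact_mod_cast n.factorial_ne_zero
    have := poch_ne (C - μ) h2 n
    field_simp
  simp only [this]
  rw [tsum_mul_left]
  have := Complex.Gamma_ne_zero h2
  have := Complex.Gamma_ne_zero_of_re_pos hB0
  have := Complex.Gamma_ne_zero_of_re_pos hA0
  field_simp

lemma main_pos (A B C μ : ℂ) (hA : μ.re < A.re) (hB : μ.re < B.re) (hμ : 0 < μ.re)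
    (h1 : ∀ n : ℕ, C ≠ -(n : ℂ)) (h2 : ∀ n : ℕ, C - μ ≠ -(n : ℂ)) (x : ℝ) (hx : 0 < x) (hx1 : x < 1) :
    ∫ y in Iio x, hypF A B C y * ((x - y : ℝ) : ℂ) ^ (μ - 1)
      = Complex.Gamma μ * (Complex.Gamma (A - μ) / Complex.Gamma A * (Complex.Gamma (B - μ) / Complex.Gamma B) *
        (Complex.Gamma C / Complex.Gamma (C - μ)) * hypF (A - μ) (B - μ) (C - μ) x) := by
  have hA0 : 0 < A.re := hμ.trans hA
  have hB0 : 0 < B.re := hμ.trans hB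
  have hBμ : 0 < (B - μ).re := by simp; linarith
  obtain ⟨M, L, hM⟩ := bound_pos B C h1
  have U := lemmaU μ A hμ hA (fun n k => poch (C - B) k * poch B n / poch C (n + k)) M _ B.re hB hM hx.le hx1
  rw [cv _ μ x 1 one_pos]
  have e1 : ∫ t in Ioo (0:ℝ) 1, hypF A B C (x - 1 * (t / (1 - t))) *
        ((t : ℂ) ^ (μ - 1) * (1 - (t : ℂ)) ^ (-μ - 1)) =
      ∫ t in Ioo (0:ℝ) 1, (∑' p : ℕ × ℕ, poch (C - B) p.2 * poch B p.1 / poch C (p.1 + p.2) * poch A (p.1 + p.2) /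
        ((p.1.factorial : ℂ) * (p.2.factorial : ℂ)) * ((x * (1 - t) : ℝ) : ℂ) ^ p.1 * (t : ℂ) ^ p.2)
          * ((t : ℂ) ^ (μ - 1) * (1 - (t : ℂ)) ^ (A - μ - 1)) := by
    refine setIntegral_congr_fun measurableSet_Ioo fun t ht => ?_
    have t1 : 0 < 1 - t := by linarith [ht.2]
    have t0 := ht.1
    have t1' : ((1 - t : ℝ) : ℂ) ≠ 0 := by exact_mod_cast t1.ne'
    have hs0 : 0 ≤ t / (1 - t) := by positivity
    have P := (pair_summable A (fun n k => poch (C - B) k * poch B n / poch C (n + k)) M L B.re hB0 hM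
      (u := x * (1 - t)) (t := t) (by positivity) t0.le (by nlinarith)).tsum_prod
    simp only at P ⊢
    rw [P, one_mul, hypF_eq_G A B C h1 (by linarith)]
    have T := (hG_taylor A B C h1 hs0 hx.le hx1).tsum_eq
    rw [Complex.ofReal_sub, ← T, show A - μ - 1 = A + (-μ - 1) by ring,
      show (1 - (t:ℂ)) = ((1 - t : ℝ) : ℂ) by push_cast; rfl, Complex.cpow_add _ _ t1']
    rw [show ∀ S p q r : ℂ, S * (p * (q * r)) = (S * q) * (p * r) by intros; ring]
    congr 1
    rw [← tsum_mul_right]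
    refine tsum_congr fun n => ?_
    rw [hP_neg _ _ _ (by linarith), show C + n - (B + n) = C - B by ring, hS, Complex.cpow_add _ _ t1', Complex.cpow_natCast,
      show ∀ p q r s S: ℂ, p * q * (r * s * S) = (p * q * s * S) * r by intros; ring, ← tsum_mul_left]
    congr 1
    refine tsum_congr fun k => ?_
    have e5 : (n.factorial : ℂ) ≠ 0 := by exact_mod_cast n.factorial_ne_zero
    have e6 : (k.factorial : ℂ) ≠ 0 := by exact_mod_cast k.factorial_ne_zero
    have e8 := poch_ne (C + n) (shift_nonpole h1 n) k
    have e9 := poch_ne C h1 n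
    rw [hco, hco, poch_add', poch_add', Complex.ofReal_mul, mul_pow]
    field_simp
  rw [e1, U]
  have in1 : ∀ n : ℕ, ∑' k : ℕ, poch (C - B) k * poch B n / poch C (n + k) * poch μ k / (k.factorial : ℂ)
      = Complex.Gamma C * Complex.Gamma (B - μ) / (Complex.Gamma (C - μ) * Complex.Gamma B) * (poch (B - μ) n / poch (C - μ) n) := by
    intro n
    have g := gauss μ (C - B) (C + n) (shift_nonpole h1 n) (by
      rw [show C + n - μ - (C - B) = B - μ + n by ring]; simp at hBμ ⊢; positivity) (by
      rw [show C + n - μ = C - μ + n by ring]; exact shift_nonpole h2 n) (by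
      rw [show C + n - (C - B) = B + n by ring]; exact shift_nonpole (nonpole_of_re hB0) n)
    rw [show C + n - μ - (C - B) = B - μ + n by ring, show C + n - μ = C - μ + n by ring,
      show C + n - (C - B) = B + n by ring, Gamma_add_nat' _ h1, Gamma_add_nat' _ h2,
      Gamma_add_nat' _ (nonpole_of_re hB0), Gamma_add_nat' _ (nonpole_of_re hBμ)] at g
    have e9 := poch_ne C h1 n
    have e10 := poch_ne B (nonpole_of_re hB0) n
    calc _ = poch B n / poch C n * ∑' k : ℕ, poch μ k * poch (C - B) k / (poch (C + n) k * (k.factorial : ℂ)) := by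
          rw [← tsum_mul_left]
          refine tsum_congr fun k => ?_
          rw [poch_add']
          have e6 : (k.factorial : ℂ) ≠ 0 := by exact_mod_cast k.factorial_ne_zero
          have e8 := poch_ne (C + n) (shift_nonpole h1 n) k
          field_simp
      _ = _ := by
          rw [g]
          have := poch_ne (C - μ) h2 n
          have := Complex.Gamma_ne_zero h2
          have := Complex.Gamma_ne_zero_of_re_pos hB0
          field_simp
  simp only [in1]
  rw [hypF, if_pos hx.le]
  have : ∀ n : ℕ, poch (A - μ) n / (n.factorial : ℂ) * (x : ℂ) ^ n * (Complex.Gamma C * Complex.Gamma (B - μ) / (Complex.Gamma (C - μ) * Complex.Gamma B) * (poch (B - μ) n / poch (C - μ) n))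
     = Complex.Gamma C * Complex.Gamma (B - μ) / (Complex.Gamma (C - μ) * Complex.Gamma B) *
      (poch (A - μ) n * poch (B - μ) n / (poch (C - μ) n * (n.factorial : ℂ)) * (x : ℂ) ^ n) := by
    intro n
    have e6 : (n.factorial : ℂ) ≠ 0 := by exact_mod_cast n.factorial_ne_zero
    have := poch_ne (C - μ) h2 n
    field_simp
  simp only [this]
  rw [tsum_mul_left, Complex.ofReal_one, Complex.one_cpow, one_mul]
  have := Complex.Gamma_ne_zero h2
  have := Complex.Gamma_ne_zero_of_re_pos hB0
  have := Complex.Gamma_ne_zero_of_re_pos hA0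
  field_simp

lemma abs_w2 (a b c d : ℂ) {y : ℝ} (hy : y ≠ 0) (h : d = c - 1) :
    ((|y| : ℝ) : ℂ) ^ d * w2 a b c y = hypF (a - c + 1) (b - c + 1) (2 - c) y := by
  have hy' : ((|y| : ℝ) : ℂ) ≠ 0 := by exact_mod_cast abs_ne_zero.2 hy
  rw [w2, ← mul_assoc, ← Complex.cpow_add _ _ hy', h, show c - 1 + (1 - c) = 0 by ring, Complex.cpow_zero, one_mul]

/-- Fractional integral transformation of type `c+` for the solution `w₂`. -/
theorem stmt_15 (a b c μ : ℂ)
    (ha : μ.re < (a - c + 1).re) (hb : μ.re < (b - c + 1).re) (hμ : 0 < μ.re)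
    (h1 : ∀ n : ℕ, 2 - c ≠ -(n : ℂ)) (h2 : ∀ n : ℕ, 2 - c - μ ≠ -(n : ℂ))
    (x : ℝ) (hx : x < 0 ∨ (0 < x ∧ x < 1)) :
    ∫ y in Iio x,
        ((|y| : ℝ) : ℂ) ^ (c - 1) * w2 a b c y *
          (((x - y : ℝ) : ℂ) ^ (μ - 1) / Complex.Gamma μ)
      = Complex.Gamma (a - c - μ + 1) / Complex.Gamma (a - c + 1) *
        (Complex.Gamma (b - c - μ + 1) / Complex.Gamma (b - c + 1)) *
        (Complex.Gamma (2 - c) / Complex.Gamma (2 - c - μ)) *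
        ((|x| : ℝ) : ℂ) ^ (c + μ - 1) * w2 a b (c + μ) x := by
  have hx0 : x ≠ 0 := by rcases hx with h | h <;> linarith
  have hG := Complex.Gamma_ne_zero_of_re_pos hμ
  rw [mul_assoc _ _ (w2 a b (c + μ) x), abs_w2 a b (c + μ) _ hx0 rfl]
  have e : ∫ y in Iio x, ((|y| : ℝ) : ℂ) ^ (c - 1) * w2 a b c y * (((x - y : ℝ) : ℂ) ^ (μ - 1) / Complex.Gamma μ)
      = (∫ y in Iio x, hypF (a - c + 1) (b - c + 1) (2 - c) y * ((x - y : ℝ) : ℂ) ^ (μ - 1)) / Complex.Gamma μ := by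
    rw [← integral_div]
    apply integral_congr_ae
    have : ∀ᵐ y : ℝ, y ≠ 0 := by simp [ae_iff]
    filter_upwards [ae_restrict_of_ae this] with y hy
    rw [abs_w2 a b c _ hy rfl, mul_div_assoc]
  have m : ∫ y in Iio x, hypF (a - c + 1) (b - c + 1) (2 - c) y * ((x - y : ℝ) : ℂ) ^ (μ - 1) = _ :=
    hx.elim (fun h => main_neg _ _ _ μ ha hb hμ h1 h2 x h) (fun h => main_pos _ _ _ μ ha hb hμ h1 h2 x h.1 h.2)
  rw [e, m, mul_div_cancel_left₀ _ hG]
  rw [show a - c + 1 - μ = a - c - μ + 1 by ring, show b - c + 1 - μ = b - c - μ + 1 by ring,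
    show a - (c + μ) + 1 = a - c - μ + 1 by ring, show b - (c + μ) + 1 = b - c - μ + 1 by ring,
    show 2 - (c + μ) = 2 - c - μ by ring]
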